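/- arXiv:2505.07009 — 2 statements merged into one kernel-verified Lean document; each statement's English description precedes it below -/
import Mathlib

section
/- Let m ≥ 2 be an integer, let n be odd with 1 ≤ n ≤ 2m−1, and let θ ∈ ℕ₀ with 0 ≤ θ ≤ 2m−n. For each choice of sign ±, there exist constants a_j^± ∈ ℂ∖ℝ for 0 ≤ j ≤ ⌊(θ−1)/2⌋ (depending only on n, m, j) and a smooth function r_θ^± : (0,∞) → ℂ such that: (a) for all λ > 0 and all x, y ∈ ℝⁿ with x ≠ y, R₀^±(λ^{2m})(x,y) = Σ_{0 ≤ j ≤ ⌊(θ−1)/2⌋} a_j^± λ^{n−2m+2j} |x−y|^{2j} + λ^{n−2m} r_θ^±(λ|x−y|); (b) for every l ∈ ℕ₀ there is a constant C_l > 0 with |d^l r_θ^±/dz^l (z)| ≤ C_l z^{max{θ−l, 0}} for 0 < z ≤ 1 and |d^l r_θ^±/dz^l (z)| ≤ C_l z^{max{θ−l, −(n−1)/2}} for z ≥ 1. -/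
open MeasureTheory Finset

/-- The coefficients `c_j` in the explicit formula for the free resolvent kernel. -/
noncomputable def cCoef (n : ℕ) (j : ℤ) : ℝ :=
  if j = -1 then -(1/2 : ℝ)
  else ((-2 : ℝ)) ^ j.toNat * (Nat.factorial (n - 3 - j.toNat)) /
      ((Nat.factorial j.toNat) * (Nat.factorial ((((n : ℤ) - 3) / 2 - j).toNat)))

/-- `λ_k = λ e^{ikπ/m}`. -/
noncomputable def lamK (m : ℕ) (lam : ℝ) (k : ℕ) : ℂ :=
  (lam : ℂ) * Complex.exp (Complex.I * (k : ℂ) * (Real.pi : ℂ) / (m : ℂ))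

/-- The limiting free resolvent kernel `R₀^±(λ^{2m})(x,y)` of `(-Δ)^m` on `ℝⁿ`, odd `n`,
as a function of `λ` and `r = |x - y|`.  The sign `+` corresponds to `sgn = true`
(with `I⁺ = {0, …, m-1}`), the sign `-` to `sgn = false` (with `I⁻ = {1, …, m}`). -/
noncomputable def R0Kernel (m n : ℕ) (sgn : Bool) (lam r : ℝ) : ℂ :=
  ((((4 * Real.pi) ^ (-(((n : ℝ) - 1) / 2)) : ℝ)) : ℂ) *
    ((m : ℂ) * (lam : ℂ) ^ (2 * m))⁻¹ *
    ∑ k ∈ (if sgn then Finset.range m else Finset.Icc 1 m),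
      (lamK m lam k) ^ 2 * Complex.exp (Complex.I * lamK m lam k * (r : ℂ)) *
        (r : ℂ) ^ (-((n : ℤ) - 2)) *
        ∑ j ∈ Finset.Icc (min 0 (((n : ℤ) - 3) / 2)) (((n : ℤ) - 3) / 2),
          ((cCoef n j : ℝ) : ℂ) * (Complex.I * lamK m lam k * (r : ℂ)) ^ j

/-- Smoothness on `(0, ∞)` together with the bounds `‖f^{(l)}(z)‖ ≤ C_l z^{e l}` for `z ∈ T`. -/
def DerivBoundOn (T : Set ℝ) (e : ℕ → ℤ) (f : ℝ → ℂ) : Prop :=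
  (∀ k : ℕ, ContDiffOn ℝ k f (Set.Ioi 0)) ∧
    ∀ l : ℕ, ∃ C : ℝ, ∀ z ∈ T, ‖iteratedDerivWithin l f (Set.Ioi 0) z‖ ≤ C * z ^ e l

namespace DerivBoundOn

variable {T : Set ℝ} {e e₁ e₂ : ℕ → ℤ} {f g : ℝ → ℂ}

theorem congr (hT : T ⊆ Set.Ioi 0) (hf : DerivBoundOn T e f) (h : Set.EqOn g f (Set.Ioi 0)) :
    DerivBoundOn T e g := by
  refine ⟨fun k => (hf.1 k).congr h, fun l => ?_⟩
  obtain ⟨C, hC⟩ := hf.2 l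
  refine ⟨C, fun z hz => ?_⟩
  rw [iteratedDerivWithin_congr h (hT hz)]
  exact hC z hz

theorem mono_exponent (hT : T ⊆ Set.Ioi 0) (hf : DerivBoundOn T e₁ f)
    (h : ∀ l, ∀ z ∈ T, z ^ e₁ l ≤ z ^ e₂ l) : DerivBoundOn T e₂ f := by
  refine ⟨hf.1, fun l => ?_⟩
  obtain ⟨C, hC⟩ := hf.2 l
  refine ⟨|C|, fun z hz => (hC z hz).trans ?_⟩
  have h0 : (0 : ℝ) < z := hT hz
  exact mul_le_mul (le_abs_self C) (h l z hz) (by positivity) (abs_nonneg C)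

theorem fun_sum {ι : Type*} (hT : T ⊆ Set.Ioi 0) (s : Finset ι) {F : ι → ℝ → ℂ}
    (h : ∀ i ∈ s, DerivBoundOn T e (F i)) : DerivBoundOn T e (fun z => ∑ i ∈ s, F i z) := by
  refine ⟨fun k => ContDiffOn.sum fun i hi => (h i hi).1 k, fun l => ?_⟩
  choose! C hC using fun i hi => (h i hi).2 l
  refine ⟨∑ i ∈ s, C i, fun z hz => ?_⟩
  rw [iteratedDerivWithin_fun_sum (hT hz) (uniqueDiffOn_Ioi 0)
    (fun i hi => (h i hi).1 l z (hT hz)), Finset.sum_mul]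
  exact norm_sum_le_of_le _ fun i hi => hC i hi z hz

theorem const_mul (c : ℂ) (hf : DerivBoundOn T e f) : DerivBoundOn T e (fun z => c * f z) := by
  refine ⟨fun k => contDiffOn_const.mul (hf.1 k), fun l => ?_⟩
  obtain ⟨C, hC⟩ := hf.2 l
  refine ⟨‖c‖ * C, fun z hz => ?_⟩
  rw [iteratedDerivWithin_const_mul_field, norm_mul, mul_assoc]
  exact mul_le_mul_of_nonneg_left (hC z hz) (norm_nonneg c)

theorem sub (hT : T ⊆ Set.Ioi 0) (hf : DerivBoundOn T e f) (hg : DerivBoundOn T e g) :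
    DerivBoundOn T e (fun z => f z - g z) := by
  refine (fun_sum (F := fun b : Bool => if b then f else fun z => -1 * g z) hT Finset.univ
    (fun b _ => ?_)).congr hT (fun z _ => ?_)
  · cases b
    · exact hg.const_mul _
    · exact hf
  · simp [sub_eq_add_neg]

theorem fun_mul (hT : T ⊆ Set.Ioi 0) (hf : DerivBoundOn T e₁ f) (hg : DerivBoundOn T e₂ g)
    (h : ∀ l, ∀ i ≤ l, ∀ z ∈ T, z ^ e₁ i * z ^ e₂ (l - i) ≤ z ^ e l) :
    DerivBoundOn T e (fun z => f z * g z) := by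
  refine ⟨fun k => (hf.1 k).mul (hg.1 k), fun l => ?_⟩
  choose A hA using hf.2
  choose B hB using hg.2
  refine ⟨∑ i ∈ range (l + 1), l.choose i * |A i| * |B (l - i)|, fun z hz => ?_⟩
  have h0 : (0 : ℝ) < z := hT hz
  change ‖iteratedDerivWithin l (f * g) _ z‖ ≤ _
  rw [iteratedDerivWithin_mul (hT hz) (uniqueDiffOn_Ioi 0) (hf.1 l z (hT hz)) (hg.1 l z (hT hz)),
    Finset.sum_mul]
  refine norm_sum_le_of_le _ fun i hi => ?_
  rw [norm_mul, norm_mul, Complex.norm_natCast]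
  have h1 : ‖iteratedDerivWithin i f (Set.Ioi 0) z‖ ≤ |A i| * z ^ e₁ i :=
    (hA i z hz).trans (mul_le_mul_of_nonneg_right (le_abs_self _) (by positivity))
  have h2 : ‖iteratedDerivWithin (l - i) g (Set.Ioi 0) z‖ ≤ |B (l - i)| * z ^ e₂ (l - i) :=
    (hB _ z hz).trans (mul_le_mul_of_nonneg_right (le_abs_self _) (by positivity))
  calc _ ≤ l.choose i * (|A i| * z ^ e₁ i) * (|B (l - i)| * z ^ e₂ (l - i)) := by gcongr
    _ = l.choose i * |A i| * |B (l - i)| * (z ^ e₁ i * z ^ e₂ (l - i)) := by ring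
    _ ≤ _ := by
      gcongr
      exact h l i (by simpa [Nat.lt_succ_iff] using hi) z hz

end DerivBoundOn

theorem contDiffOn_ofReal_zpow (k : ℕ) (p : ℤ) :
    ContDiffOn ℝ k (fun z : ℝ => (z : ℂ) ^ p) (Set.Ioi 0) := by
  intro z hz
  have hz' : (z : ℂ) ≠ 0 := by exact_mod_cast (ne_of_gt hz : z ≠ 0)
  have h1 : ContDiffAt ℝ k (fun z : ℝ => (z : ℂ)) z := Complex.ofRealCLM.contDiff.contDiffAt
  refine ContDiffAt.contDiffWithinAt ?_
  cases p with
  | ofNat a => simpa using h1.pow a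
  | negSucc a => simp only [zpow_negSucc]; exact (h1.pow (a + 1)).inv (pow_ne_zero _ hz')

theorem iteratedDerivWithin_ofReal_zpow (p : ℤ) (l : ℕ) :
    Set.EqOn (iteratedDerivWithin l (fun z : ℝ => (z : ℂ) ^ p) (Set.Ioi 0))
      (fun z => (∏ i ∈ range l, ((p : ℂ) - i)) * (z : ℂ) ^ (p - l)) (Set.Ioi 0) := by
  induction l with
  | zero => intro z _; simp
  | succ l ih =>
    intro z hz
    have hz' : (z : ℂ) ≠ 0 := by exact_mod_cast (ne_of_gt hz : z ≠ 0)
    rw [iteratedDerivWithin_succ, derivWithin_congr ih (ih hz),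
      derivWithin_of_isOpen isOpen_Ioi hz]
    have h := ((hasDerivAt_zpow (p - l) (z : ℂ) (Or.inl hz')).comp_ofReal).const_mul
      (∏ i ∈ range l, ((p : ℂ) - i))
    rw [h.deriv, prod_range_succ]
    push_cast
    rw [mul_assoc]
    congr 3
    ring

theorem derivBoundOn_zpow {T : Set ℝ} (hT : T ⊆ Set.Ioi 0) (p : ℤ) :
    DerivBoundOn T (fun l => p - l) (fun z : ℝ => (z : ℂ) ^ p) := by
  refine ⟨fun k => contDiffOn_ofReal_zpow k p,
    fun l => ⟨‖∏ i ∈ range l, ((p : ℂ) - i)‖, fun z hz => ?_⟩⟩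
  have h0 : (0 : ℝ) < z := hT hz
  rw [iteratedDerivWithin_ofReal_zpow p l (hT hz), norm_mul, norm_zpow, Complex.norm_real,
    Real.norm_of_nonneg h0.le]

theorem derivBoundOn_pow {T : Set ℝ} (hT : T ⊆ Set.Ioi 0) (n : ℕ) :
    DerivBoundOn T (fun l => max ((n : ℤ) - l) 0) (fun z : ℝ => (z : ℂ) ^ (n : ℤ)) := by
  refine ⟨fun k => contDiffOn_ofReal_zpow k n, fun l => ?_⟩
  obtain ⟨C, hC⟩ := (derivBoundOn_zpow hT n).2 l
  rcases le_or_gt l n with h | h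
  · refine ⟨C, fun z hz => ?_⟩
    simpa only [max_eq_left (show (0 : ℤ) ≤ (n : ℤ) - l by omega)] using hC z hz
  · refine ⟨0, fun z hz => ?_⟩
    rw [iteratedDerivWithin_ofReal_zpow n l (hT hz),
      prod_eq_zero (mem_range.2 h) (by simp)]
    simp

theorem iteratedDerivWithin_cexp_mul_ofReal (c : ℂ) (l : ℕ) :
    Set.EqOn (iteratedDerivWithin l (fun z : ℝ => Complex.exp (c * z)) (Set.Ioi 0))
      (fun z => c ^ l * Complex.exp (c * z)) (Set.Ioi 0) := by
  induction l with
  | zero => intro z _; simp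
  | succ l ih =>
    intro z hz
    rw [iteratedDerivWithin_succ, derivWithin_congr ih (ih hz),
      derivWithin_of_isOpen isOpen_Ioi hz]
    have h := (((((hasDerivAt_id (z : ℂ)).const_mul c).cexp).comp_ofReal)).const_mul (c ^ l)
    simp only [id, mul_one] at h
    rw [h.deriv]
    ring

theorem derivBoundOn_cexp {T : Set ℝ} (hT : T ⊆ Set.Ioi 0) {c : ℂ} (hc : c.re ≤ 0) :
    DerivBoundOn T (fun _ => 0) (fun z : ℝ => Complex.exp (c * z)) := by
  refine ⟨fun k => ?_, fun l => ⟨‖c ^ l‖, fun z hz => ?_⟩⟩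
  · have h1 : ContDiff ℝ k (fun z : ℝ => (z : ℂ)) := Complex.ofRealCLM.contDiff
    exact ((contDiff_const.mul h1).cexp).contDiffOn
  have h0 : (0 : ℝ) < z := hT hz
  rw [iteratedDerivWithin_cexp_mul_ofReal c l (hT hz), norm_mul, Complex.norm_exp, zpow_zero]
  refine mul_le_mul_of_nonneg_left (Real.exp_le_one_iff.2 ?_) (norm_nonneg _)
  simpa using mul_nonpos_of_nonpos_of_nonneg hc h0.le

theorem derivBoundOn_Ioc_of_contDiff {f : ℝ → ℂ} (hf : ∀ k : ℕ, ContDiff ℝ k f) :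
    DerivBoundOn (Set.Ioc 0 1) (fun _ => 0) f := by
  refine ⟨fun k => (hf k).contDiffOn, fun l => ?_⟩
  obtain ⟨C, hC⟩ := (isCompact_Icc (a := (0 : ℝ)) (b := 1)).exists_bound_of_continuousOn
    ((hf l).continuous_iteratedDeriv' l).continuousOn
  refine ⟨C, fun z hz => ?_⟩
  rw [iteratedDerivWithin_of_isOpen isOpen_Ioi hz.1]
  simpa using hC z ⟨hz.1.le, hz.2⟩

theorem differentiable_dslope {f : ℂ → ℂ} (hf : Differentiable ℂ f) (c : ℂ) :
    Differentiable ℂ (dslope f c) := by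
  rw [← differentiableOn_univ] at hf ⊢
  exact (Complex.differentiableOn_dslope Filter.univ_mem).2 hf

/-- Taylor expansion of the exponential with an entire remainder. -/
theorem exists_exp_taylor_remainder (N : ℕ) :
    ∃ g : ℂ → ℂ, Differentiable ℂ g ∧
      ∀ w : ℂ, Complex.exp w = ∑ s ∈ range N, w ^ s / (s.factorial : ℂ) + w ^ N * g w := by
  have hp : HasFPowerSeriesAt Complex.exp (NormedSpace.expSeries ℂ ℂ) 0 := by
    rw [Complex.exp_eq_exp_ℂ]
    exact NormedSpace.exp_hasFPowerSeriesAt_zero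
  let G : ℕ → ℂ → ℂ := fun k => (Function.swap dslope 0)^[k] Complex.exp
  have hG : ∀ k, G (k + 1) = dslope (G k) 0 := fun k => Function.iterate_succ_apply' _ _ _
  have hdiff : ∀ k, Differentiable ℂ (G k) := fun k => by
    induction k with
    | zero => exact Complex.differentiable_exp
    | succ k ih => rw [hG]; exact differentiable_dslope ih 0
  have hG0 : ∀ k, G k 0 = ((k.factorial : ℂ))⁻¹ := fun k => by
    have h := (hp.has_fpower_series_iterate_dslope_fslope k).coeff_zero 1
    rw [show G k 0 = _ from h.symm]
    change FormalMultilinearSeries.coeff _ 0 = _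
    rw [FormalMultilinearSeries.coeff_iterate_fslope, zero_add]
    simp [FormalMultilinearSeries.coeff, NormedSpace.expSeries, List.prod_ofFn]
  refine ⟨G N, hdiff N, fun w => ?_⟩
  induction N with
  | zero => simp [G]
  | succ N ih =>
    rw [ih, sum_range_succ, hG, add_assoc]
    congr 1
    have h := sub_smul_dslope (G N) 0 w
    rw [sub_zero, smul_eq_mul, hG0] at h
    rw [pow_succ, mul_assoc, h]
    ring

theorem integral_pow_mul_one_sub_pow (a b : ℕ) :
    ∫ x in (0 : ℝ)..1, x ^ a * (1 - x) ^ b =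
      (a.factorial * b.factorial : ℝ) / (a + b + 1).factorial := by
  induction b generalizing a with
  | zero =>
    simp only [pow_zero, mul_one, integral_pow, Nat.factorial_succ, add_zero]
    push_cast
    have := Nat.factorial_ne_zero a
    field_simp
    simp
  | succ b ih =>
    have hu : ∀ x ∈ Set.uIcc (0 : ℝ) 1,
        HasDerivAt (fun x : ℝ => (1 - x) ^ (b + 1)) (-((b + 1) * (1 - x) ^ b)) x := fun x _ => by
      have h := ((hasDerivAt_id x).const_sub 1).pow (b + 1)
      simp only [id] at h
      convert! h using 1
      push_cast
      simp
    have hv : ∀ x ∈ Set.uIcc (0 : ℝ) 1,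
        HasDerivAt (fun x : ℝ => x ^ (a + 1)) ((a + 1) * x ^ a) x := fun x _ => by
      simpa using hasDerivAt_pow (a + 1) x
    have h := intervalIntegral.integral_mul_deriv_eq_deriv_mul hu hv
      (by apply Continuous.intervalIntegrable; fun_prop)
      (by apply Continuous.intervalIntegrable; fun_prop)
    have e1 : ∀ x : ℝ, (1 - x) ^ (b + 1) * ((a + 1) * x ^ a) =
      (a + 1) * (x ^ a * (1 - x) ^ (b + 1)) := fun x => by ring
    have e2 : ∀ x : ℝ, -((b + 1) * (1 - x) ^ b) * x ^ (a + 1) =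
      -(b + 1) * (x ^ (a + 1) * (1 - x) ^ b) := fun x => by ring
    simp only [e1, e2, intervalIntegral.integral_const_mul, ih] at h
    have ha : (a + 1 : ℝ) ≠ 0 := by positivity
    apply mul_left_cancel₀ ha
    rw [h, show a + 1 + b + 1 = a + (b + 1) + 1 by ring, Nat.factorial_succ a,
      Nat.factorial_succ b]
    push_cast
    simp
    ring

theorem sum_choose_mul_neg_two_pow_mul_choose_eq_zero (p k : ℕ) (hk : Odd k) :
    ∑ j ∈ range (p + 1), (p.choose j : ℝ) * (-2) ^ j * ((2 * p - j).choose k) = 0 := by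
  open Polynomial in
  have h : ∑ j ∈ range (p + 1), C ((p.choose j : ℝ) * (-2) ^ j) * (1 + X) ^ (2 * p - j) =
      Polynomial.expand ℝ 2 ((X - 1) ^ p) := by
    have h1 : Polynomial.expand ℝ 2 ((X - 1) ^ p) = (C (-2) + (1 + X)) ^ p * (1 + X) ^ p := by
      rw [← mul_pow, map_pow, map_sub, Polynomial.expand_X, map_one]
      congr 1
      rw [C_neg, show (C 2 : ℝ[X]) = 2 from rfl]
      ring
    rw [h1, add_pow, sum_mul]
    refine sum_congr rfl fun j hj => ?_
    have hj' : j ≤ p := by simpa [Nat.lt_succ_iff] using hj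
    rw [show 2 * p - j = (p - j) + p by omega, pow_add]
    simp only [C_mul, C_pow, map_natCast]
    ring
  have h2 := congrArg (fun f => Polynomial.coeff f k) h
  simp only [Polynomial.finsetSum_coeff, Polynomial.coeff_C_mul,
    Polynomial.coeff_one_add_X_pow, Polynomial.coeff_expand two_pos] at h2
  rw [h2, if_neg]
  rwa [← even_iff_two_dvd, Nat.not_even_iff_odd]

theorem sum_choose_mul_neg_two_pow_mul_factorial_ne_zero (p b : ℕ) :
    ∑ j ∈ range (p + 1), (p.choose j : ℝ) * (-2) ^ j *
      ((2 * p - j).factorial / (2 * p + 1 + b - j).factorial) ≠ 0 := by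
  have hb : (b.factorial : ℝ) ≠ 0 := by exact_mod_cast b.factorial_ne_zero
  have h : ∫ x in (0 : ℝ)..1, (-2 + x) ^ p * x ^ p * (1 - x) ^ b =
      b.factorial * ∑ j ∈ range (p + 1), (p.choose j : ℝ) * (-2) ^ j *
      ((2 * p - j).factorial / (2 * p + 1 + b - j).factorial) := by
    have e : ∀ x : ℝ, (-2 + x) ^ p * x ^ p * (1 - x) ^ b =
        ∑ j ∈ range (p + 1), (p.choose j : ℝ) * (-2) ^ j * (x ^ (2 * p - j) * (1 - x) ^ b) := by
      intro x
      rw [add_pow, sum_mul, sum_mul]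
      refine sum_congr rfl fun j hj => ?_
      have hj' : j ≤ p := by simpa [Nat.lt_succ_iff] using hj
      rw [show 2 * p - j = (p - j) + p by omega, pow_add]
      ring
    simp only [e]
    rw [intervalIntegral.integral_finsetSum
      (fun j _ => by apply Continuous.intervalIntegrable; fun_prop), mul_sum]
    refine sum_congr rfl fun j hj => ?_
    have hj' : j ≤ p := by simpa [Nat.lt_succ_iff] using hj
    rw [intervalIntegral.integral_const_mul, integral_pow_mul_one_sub_pow,
      show 2 * p - j + b + 1 = 2 * p + 1 + b - j by omega]
    ring
  have hpos : 0 < ∫ x in (0 : ℝ)..1, (2 - x) ^ p * x ^ p * (1 - x) ^ b := by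
    refine intervalIntegral.intervalIntegral_pos_of_pos_on
      (by apply Continuous.intervalIntegrable; fun_prop) (fun x hx => ?_) one_pos
    have h1 : 0 < 2 - x := by linarith [hx.2]
    have h2 : 0 < 1 - x := by linarith [hx.2]
    have h3 := hx.1
    positivity
  intro h0
  rw [h0, mul_zero] at h
  have e : ∀ x : ℝ, (-2 + x) ^ p * x ^ p * (1 - x) ^ b =
      (-1) ^ p * ((2 - x) ^ p * x ^ p * (1 - x) ^ b) := fun x => by
    rw [show -2 + x = -1 * (2 - x) by ring, mul_pow]
    ring
  simp only [e, intervalIntegral.integral_const_mul] at h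
  rcases mul_eq_zero.1 h with h | h
  · exact pow_ne_zero _ (by norm_num) h
  · exact hpos.ne' h

/-- The coefficients of `w ∑ j, c_j w ^ j` in dimension `n = 2 q + 1`. -/
noncomputable def polyCoef (q j : ℕ) : ℝ :=
  if j = 0 ∧ q ≠ 0 then 0 else cCoef (2 * q + 1) ((j : ℤ) - 1)

/-- The Taylor coefficients at `0` of `w e ^ w ∑ j, c_j w ^ j` in dimension `n = 2 q + 1`. -/
noncomputable def taylorCoef (q s : ℕ) : ℝ :=
  ∑ j ∈ range (q + 1), if j ≤ s then polyCoef q j / ((s - j).factorial : ℝ) else 0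

theorem polyCoef_succ (p j : ℕ) (hj : j ≤ p) :
    polyCoef (p + 1) (j + 1) =
      (p.factorial : ℝ)⁻¹ * ((p.choose j : ℝ) * (-2) ^ j * (2 * p - j).factorial) := by
  have h1 : ((((2 * (p + 1) + 1 : ℕ) : ℤ) - 3) / 2 - (j : ℤ)).toNat = p - j := by omega
  have h2 : 2 * (p + 1) + 1 - 3 - j = 2 * p - j := by omega
  have h3 : ¬((j : ℤ) = -1) := by omega
  have hp : (p.factorial : ℝ) ≠ 0 := by exact_mod_cast p.factorial_ne_zero
  simp only [polyCoef, cCoef, Nat.cast_add, Nat.cast_one, add_sub_cancel_right] at h1 ⊢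
  rw [if_neg (by simp), if_neg h3, Int.toNat_natCast, h1, h2, Nat.cast_choose ℝ hj]
  field_simp

theorem taylorCoef_succ (p s : ℕ) :
    taylorCoef (p + 1) s = (p.factorial : ℝ)⁻¹ * ∑ j ∈ range (p + 1),
      if j + 1 ≤ s then (p.choose j : ℝ) * (-2) ^ j *
        ((2 * p - j).factorial / ((s - (j + 1)).factorial : ℝ)) else 0 := by
  rw [taylorCoef, sum_range_succ', mul_sum]
  have h0 : polyCoef (p + 1) 0 = 0 := by simp [polyCoef]
  rw [h0]
  simp only [zero_div, ite_self, add_zero]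
  refine sum_congr rfl fun j hj => ?_
  have hj' : j ≤ p := by simpa [Nat.lt_succ_iff] using hj
  rw [polyCoef_succ p j hj']
  split_ifs
  · ring
  · simp

theorem taylorCoef_eq_zero {q s : ℕ} (hs : Even s) (hsq : s < 2 * q) : taylorCoef q s = 0 := by
  obtain ⟨p, rfl⟩ : ∃ p, q = p + 1 := ⟨q - 1, by omega⟩
  rw [taylorCoef_succ]
  rcases s with _ | t
  · simp
  have ht : Odd t := by simpa [Nat.even_add_one] using hs
  have htp : t ≤ 2 * p := by omega
  have hk : Odd (2 * p - t) := by
    obtain ⟨u, rfl⟩ := ht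
    exact ⟨p - u - 1, by omega⟩
  rw [mul_eq_zero]
  right
  have h := sum_choose_mul_neg_two_pow_mul_choose_eq_zero p (2 * p - t) hk
  have hf : ((2 * p - t).factorial : ℝ) ≠ 0 := by exact_mod_cast Nat.factorial_ne_zero _
  refine Eq.trans ?_ ((congrArg (((2 * p - t).factorial : ℝ) * ·) h).trans (mul_zero _))
  simp only [mul_sum]
  refine sum_congr rfl fun j hj => ?_
  have hj' : j ≤ p := by simpa [Nat.lt_succ_iff] using hj
  split_ifs with hjt
  · have hjt' : j ≤ t := by omega
    rw [Nat.cast_choose ℝ (show 2 * p - t ≤ 2 * p - j by omega),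
      show 2 * p - j - (2 * p - t) = t - j by omega, show t + 1 - (j + 1) = t - j by omega]
    field_simp
  · rw [Nat.choose_eq_zero_of_lt (show 2 * p - j < 2 * p - t by omega)]
    simp

theorem taylorCoef_ne_zero {q s : ℕ} (hsq : 2 * q ≤ s) : taylorCoef q s ≠ 0 := by
  rcases q with _ | p
  · simp [taylorCoef, polyCoef, cCoef, Nat.factorial_ne_zero]
  obtain ⟨b, rfl⟩ := Nat.exists_eq_add_of_le hsq
  rw [taylorCoef_succ]
  refine mul_ne_zero (by simp [Nat.factorial_ne_zero]) ?_
  refine ne_of_eq_of_ne ?_ (sum_choose_mul_neg_two_pow_mul_factorial_ne_zero p b)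
  refine sum_congr rfl fun j hj => ?_
  have hj' : j ≤ p := by simpa [Nat.lt_succ_iff] using hj
  rw [if_pos (by omega), show 2 * (p + 1) + b - (j + 1) = 2 * p + 1 + b - j by omega]

theorem sum_cCoef_mul_zpow (q : ℕ) {w : ℂ} (hw : w ≠ 0) :
    ∑ j ∈ Finset.Icc (min 0 ((((2 * q + 1 : ℕ) : ℤ) - 3) / 2)) ((((2 * q + 1 : ℕ) : ℤ) - 3) / 2),
      ((cCoef (2 * q + 1) j : ℝ) : ℂ) * w ^ j =
      w⁻¹ * ∑ j ∈ range (q + 1), ((polyCoef q j : ℝ) : ℂ) * w ^ j := by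
  rcases q with _ | p
  · have h : (((2 * 0 + 1 : ℕ) : ℤ) - 3) / 2 = -1 := by norm_num
    rw [h]
    simp [polyCoef, mul_comm]
  have h : (((2 * (p + 1) + 1 : ℕ) : ℤ) - 3) / 2 = p := by omega
  have h0 : polyCoef (p + 1) 0 = 0 := by simp [polyCoef]
  rw [h, min_eq_left (by omega), sum_range_succ', h0, Complex.ofReal_zero, zero_mul, add_zero,
    mul_sum]
  symm
  refine sum_bij' (fun j _ => (j : ℤ)) (fun j _ => j.toNat) ?_ ?_ ?_ ?_ ?_
  · intro j hj; simp at hj ⊢; omega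
  · intro j hj; simp at hj ⊢; omega
  · intro j hj; simp
  · intro j hj; simp at hj ⊢; omega
  · intro j hj
    simp only [polyCoef, zpow_natCast, pow_succ, Nat.cast_add, Nat.cast_one,
      add_sub_cancel_right]
    rw [if_neg (by simp)]
    field_simp

/-- Taylor expansion of `e ^ w` times a polynomial, with an entire remainder. -/
theorem exists_taylor_remainder {q N : ℕ} (hqN : q ≤ N) :
    ∃ g : ℂ → ℂ, Differentiable ℂ g ∧ ∀ w : ℂ,
      Complex.exp w * ∑ j ∈ range (q + 1), ((polyCoef q j : ℝ) : ℂ) * w ^ j =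
        ∑ s ∈ range N, ((taylorCoef q s : ℝ) : ℂ) * w ^ s + w ^ N * g w := by
  choose G hG hexp using exists_exp_taylor_remainder
  refine ⟨fun w => ∑ j ∈ range (q + 1), ((polyCoef q j : ℝ) : ℂ) * G (N - j) w,
    Differentiable.fun_sum fun j _ => (hG _).const_mul _, fun w => ?_⟩
  simp only [taylorCoef, Complex.ofReal_sum, sum_mul]
  rw [sum_comm, mul_sum, mul_sum, ← sum_add_distrib]
  refine sum_congr rfl fun j hj => ?_
  have hj' : j ≤ N := by
    have : j < q + 1 := mem_range.1 hj
    omega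
  obtain ⟨M, rfl⟩ := Nat.exists_eq_add_of_le hj'
  rw [show j + M - j = M by omega, sum_range_add, hexp M w]
  have h1 : ∑ s ∈ range j, (((if j ≤ s then polyCoef q j / ((s - j).factorial : ℝ) else 0 : ℝ)) : ℂ)
      * w ^ s = 0 := sum_eq_zero fun s hs => by
    rw [if_neg (by simpa using hs)]
    simp
  rw [h1, zero_add, add_mul, sum_mul]
  congr 1
  · refine sum_congr rfl fun s _ => ?_
    rw [if_pos (by omega), show j + s - j = s by omega]
    push_cast
    ring
  · ring

/-- The sums `∑ k, e ^ {i k t π / m}` over the index sets of the two resolvent kernels. -/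
noncomputable def rootSum (m : ℕ) (sgn : Bool) (t : ℕ) : ℂ :=
  ∑ k ∈ (if sgn then Finset.range m else Finset.Icc 1 m), lamK m 1 k ^ t

theorem lamK_one_pow (m k t : ℕ) :
    lamK m 1 k ^ t = Complex.exp ((Real.pi * t / m : ℝ) * Complex.I) ^ k := by
  rw [lamK, Complex.ofReal_one, one_mul, ← Complex.exp_nat_mul, ← Complex.exp_nat_mul]
  congr 1
  push_cast
  ring

theorem rootSum_eq (m : ℕ) (sgn : Bool) (t : ℕ) :
    rootSum m sgn t = (if sgn then 1 else Complex.exp ((Real.pi * t / m : ℝ) * Complex.I)) *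
      ∑ k ∈ range m, Complex.exp ((Real.pi * t / m : ℝ) * Complex.I) ^ k := by
  simp only [rootSum, lamK_one_pow]
  cases sgn
  · simp only [Bool.false_eq_true, if_false]
    rw [mul_sum, ← Finset.Ico_add_one_right_eq_Icc, sum_Ico_eq_sum_range]
    refine sum_congr (by simp) fun k _ => ?_
    rw [add_comm, pow_succ, mul_comm]
  · simp

theorem exp_pow_eq_neg_one_pow {m : ℕ} (hm : m ≠ 0) (t : ℕ) :
    Complex.exp ((Real.pi * t / m : ℝ) * Complex.I) ^ m = (-1) ^ t := by
  have hm' : (m : ℂ) ≠ 0 := by exact_mod_cast hm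
  rw [← Complex.exp_pi_mul_I, ← Complex.exp_nat_mul, ← Complex.exp_nat_mul]
  congr 1
  push_cast
  field_simp

theorem rootSum_eq_zero {m : ℕ} (sgn : Bool) {t : ℕ} (ht : Even t) (ht0 : t ≠ 0)
    (htm : t < 2 * m) : rootSum m sgn t = 0 := by
  have hm : m ≠ 0 := by omega
  rw [rootSum_eq, mul_eq_zero]
  right
  have h := mul_neg_geom_sum (Complex.exp ((Real.pi * t / m : ℝ) * Complex.I)) m
  rw [exp_pow_eq_neg_one_pow hm, ht.neg_one_pow, sub_self, mul_eq_zero] at h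
  refine h.resolve_left fun h1 => ?_
  obtain ⟨k, hk⟩ := Complex.exp_eq_one_iff.1 (sub_eq_zero.1 h1).symm
  have hk' : (Real.pi * t / m : ℝ) * Complex.I = ((k * (2 * Real.pi) : ℝ) : ℂ) * Complex.I := by
    rw [hk]; push_cast; ring
  have h2 := Complex.ofReal_injective (mul_right_cancel₀ Complex.I_ne_zero hk')
  have hm' : (m : ℝ) ≠ 0 := by exact_mod_cast hm
  have h3 : (t : ℝ) = 2 * m * k := by
    apply mul_left_cancel₀ Real.pi_ne_zero
    field_simp at h2
    linear_combination Real.pi * h2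
  have h4 : (t : ℤ) = 2 * m * k := by exact_mod_cast h3
  have h5 : (2 * m : ℤ) ∣ t := ⟨k, h4⟩
  have h6 := Int.le_of_dvd (by omega) h5
  omega

theorem rootSum_re_ne_zero {m : ℕ} (hm : m ≠ 0) (sgn : Bool) {t : ℕ} (ht : Odd t) :
    (rootSum m sgn t).re ≠ 0 := by
  rw [rootSum_eq]
  have hxm := exp_pow_eq_neg_one_pow hm t
  have hnorm : ‖Complex.exp ((Real.pi * t / m : ℝ) * Complex.I)‖ = 1 :=
    Complex.norm_exp_ofReal_mul_I _
  generalize Complex.exp ((Real.pi * t / m : ℝ) * Complex.I) = x at *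
  have h := mul_neg_geom_sum x m
  rw [hxm, ht.neg_one_pow] at h
  generalize ∑ k ∈ range m, x ^ k = G at *
  have hx1 : x ≠ 1 := by
    rintro rfl
    norm_num at h
  have hx : x.re ^ 2 + x.im ^ 2 = 1 := by
    have := Complex.sq_norm x
    rw [hnorm, Complex.normSq_apply] at this
    linarith
  have hre : x.re ≠ 1 := by
    intro h1
    apply hx1
    apply Complex.ext
    · simpa using h1
    · rw [h1] at hx
      have : x.im ^ 2 = 0 := by linarith
      simpa using this
  have e1 := congrArg Complex.re h
  have e2 := congrArg Complex.im h
  simp at e1 e2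
  have hG : G.re = 1 := by
    apply mul_left_cancel₀ (sub_ne_zero.2 (Ne.symm hre))
    linear_combination (1 - x.re) / 2 * e1 - x.im / 2 * e2 - G.re / 2 * hx
  cases sgn
  · simp
    intro h0
    linarith
  · simp [hG]

theorem lamK_eq_mul (m : ℕ) (lam : ℝ) (k : ℕ) : lamK m lam k = lam * lamK m 1 k := by
  simp [lamK]

theorem lamK_ne_zero (m : ℕ) (k : ℕ) : lamK m 1 k ≠ 0 := by
  simp [lamK, Complex.exp_ne_zero]

theorem I_mul_lamK_re_nonpos {m k : ℕ} (hk : k ≤ m) : (Complex.I * lamK m 1 k).re ≤ 0 := by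
  have h : lamK m 1 k = Complex.exp ((k * Real.pi / m : ℝ) * Complex.I) := by
    rw [lamK, Complex.ofReal_one, one_mul]
    congr 1
    push_cast
    ring
  rw [h, Complex.I_mul_re, Complex.exp_ofReal_mul_I_im, neg_nonpos]
  refine Real.sin_nonneg_of_nonneg_of_le_pi (by positivity) ?_
  refine div_le_of_le_mul₀ (by positivity) Real.pi_pos.le ?_
  rw [mul_comm]
  have : (k : ℝ) ≤ m := by exact_mod_cast hk
  gcongr

theorem R0Kernel_scaling (m n : ℕ) (sgn : Bool) {lam r : ℝ} (hlam : 0 < lam) (hr : 0 < r) :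
    R0Kernel m n sgn lam r =
      (((lam ^ ((n : ℤ) - 2 * (m : ℤ))) : ℝ) : ℂ) * R0Kernel m n sgn 1 (lam * r) := by
  have hl : (lam : ℂ) ≠ 0 := by exact_mod_cast hlam.ne'
  have hr' : (r : ℂ) ≠ 0 := by exact_mod_cast hr.ne'
  simp only [R0Kernel, lamK_eq_mul m lam, Complex.ofReal_mul, Complex.ofReal_one, one_pow, mul_one]
  have e : ∀ k, Complex.I * (lam * lamK m 1 k) * r = Complex.I * lamK m 1 k * (lam * r) :=
    fun k => by ring
  simp only [e, mul_sum]
  refine sum_congr rfl fun k _ => sum_congr rfl fun j _ => ?_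
  have h : (lam : ℂ) ^ ((n : ℤ) - 2 * m) * ((lam : ℂ) * r) ^ (-((n : ℤ) - 2)) =
      ((lam : ℂ) ^ (2 * m))⁻¹ * lam ^ 2 * (r : ℂ) ^ (-((n : ℤ) - 2)) := by
    rw [mul_zpow, ← mul_assoc, ← zpow_add₀ hl, ← zpow_natCast, ← zpow_natCast, ← zpow_neg,
      ← zpow_add₀ hl]
    congr 2
    push_cast
    ring
  push_cast
  rw [mul_inv]
  linear_combination (-(((4 * Real.pi : ℝ) ^ (-(((n : ℝ) - 1) / 2)) : ℝ) : ℂ) * (m : ℂ)⁻¹ *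
    lamK m 1 k ^ 2 * Complex.exp (Complex.I * lamK m 1 k * (lam * r)) *
    ((cCoef n j : ℂ) * (Complex.I * lamK m 1 k * (lam * r)) ^ j)) * h

/-- The real normalizing factor of the kernel at `λ = 1`. -/
noncomputable def kernelFactor (m q : ℕ) : ℝ :=
  (4 * Real.pi) ^ (-((((2 * q + 1 : ℕ) : ℝ) - 1) / 2)) * (m : ℝ)⁻¹

theorem kernelFactor_ne_zero {m : ℕ} (hm : m ≠ 0) (q : ℕ) : kernelFactor m q ≠ 0 := by
  have : (0 : ℝ) < m := by exact_mod_cast Nat.pos_of_ne_zero hm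
  have := Real.pi_pos
  unfold kernelFactor
  positivity

theorem R0Kernel_one (m q : ℕ) (sgn : Bool) {z : ℝ} (hz : 0 < z) :
    R0Kernel m (2 * q + 1) sgn 1 z = -Complex.I * kernelFactor m q *
      ∑ k ∈ (if sgn then Finset.range m else Finset.Icc 1 m), lamK m 1 k * (z : ℂ) ^ (-(2 * q : ℤ)) *
        (Complex.exp (Complex.I * lamK m 1 k * z) *
          ∑ j ∈ range (q + 1), ((polyCoef q j : ℝ) : ℂ) * (Complex.I * lamK m 1 k * z) ^ j) := by
  have hz' : (z : ℂ) ≠ 0 := by exact_mod_cast hz.ne'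
  rw [R0Kernel, mul_sum, mul_sum]
  refine sum_congr rfl fun k _ => ?_
  have hk := lamK_ne_zero m k
  rw [sum_cCoef_mul_zpow q (mul_ne_zero (mul_ne_zero Complex.I_ne_zero hk) hz'),
    show -(((2 * q + 1 : ℕ) : ℤ) - 2) = -(2 * q : ℤ) + 1 by push_cast; ring, zpow_add₀ hz',
    kernelFactor, mul_inv, mul_inv, mul_inv, Complex.inv_I]
  push_cast
  field_simp
  simp

theorem sum_range_eq_sum_even {f : ℕ → ℂ} (hf : ∀ t, Odd t → f t = 0) (N : ℕ) :
    ∑ t ∈ range N, f t = ∑ j ∈ range ((N + 1) / 2), f (2 * j) := by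
  induction N with
  | zero => simp
  | succ N ih =>
    rw [sum_range_succ, ih]
    rcases Nat.even_or_odd' N with ⟨c, rfl | rfl⟩
    · rw [show (2 * c + 1) / 2 = c by omega, show (2 * c + 1 + 1) / 2 = c + 1 by omega,
        sum_range_succ]
    · rw [hf _ ⟨c, rfl⟩, add_zero, show (2 * c + 1 + 1) / 2 = (2 * c + 1 + 1 + 1) / 2 by omega]

/-- The coefficient of `z ^ (2 j)` in the expansion of the kernel at `λ = 1`. -/
noncomputable def expansionCoef (m q : ℕ) (sgn : Bool) (j : ℕ) : ℂ :=
  -Complex.I * kernelFactor m q * ((taylorCoef q (2 * q + 2 * j) : ℝ) : ℂ) *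
    Complex.I ^ (2 * q + 2 * j) * rootSum m sgn (2 * q + 2 * j + 1)

theorem expansionCoef_im_ne_zero {m : ℕ} (hm : m ≠ 0) (q : ℕ) (sgn : Bool) (j : ℕ) :
    (expansionCoef m q sgn j).im ≠ 0 := by
  have h1 : expansionCoef m q sgn j = ((-(kernelFactor m q * taylorCoef q (2 * q + 2 * j) *
      (-1) ^ (q + j)) : ℝ) : ℂ) * (Complex.I * rootSum m sgn (2 * q + 2 * j + 1)) := by
    rw [expansionCoef, show 2 * q + 2 * j = 2 * (q + j) by ring, pow_mul, Complex.I_sq]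
    push_cast
    ring
  rw [h1, Complex.im_ofReal_mul, Complex.I_mul_im]
  exact mul_ne_zero (neg_ne_zero.2 (mul_ne_zero (mul_ne_zero (kernelFactor_ne_zero hm q)
    (taylorCoef_ne_zero (by omega))) (pow_ne_zero _ (by norm_num))))
    (rootSum_re_ne_zero hm sgn ⟨q + j, by ring⟩)

theorem sum_taylorCoef_mul_rootSum {m q θ : ℕ} (sgn : Bool) (hθ : 2 * q + θ + 1 ≤ 2 * m) (z : ℂ) :
    -Complex.I * kernelFactor m q * ∑ s ∈ range (2 * q + θ),
      ((taylorCoef q s : ℝ) : ℂ) * Complex.I ^ s * rootSum m sgn (s + 1) * z ^ s =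
      z ^ (2 * q) * ∑ j ∈ range ((θ + 1) / 2), expansionCoef m q sgn j * z ^ (2 * j) := by
  have hodd : ∀ s, Odd s → s < 2 * q + θ → rootSum m sgn (s + 1) = 0 := fun s hs hlt =>
    rootSum_eq_zero sgn hs.add_one (by omega) (by omega)
  rw [sum_range_add, sum_eq_zero, zero_add]
  · let f : ℕ → ℂ := fun t => if t < θ then ((taylorCoef q (2 * q + t) : ℝ) : ℂ) *
      Complex.I ^ (2 * q + t) * rootSum m sgn (2 * q + t + 1) * z ^ (2 * q + t) else 0
    have hf : ∀ t, Odd t → f t = 0 := fun t ht => by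
      by_cases h : t < θ
      · simp only [f, if_pos h]
        rw [hodd (2 * q + t) ((even_two_mul q).add_odd ht) (by omega)]
        simp
      · simp [f, h]
    have h := sum_range_eq_sum_even hf θ
    have h' : ∑ t ∈ range θ, f t = ∑ t ∈ range θ, ((taylorCoef q (2 * q + t) : ℝ) : ℂ) *
      Complex.I ^ (2 * q + t) * rootSum m sgn (2 * q + t + 1) * z ^ (2 * q + t) :=
      sum_congr rfl fun t ht => if_pos (mem_range.1 ht)
    rw [← h', h, mul_sum, mul_sum]
    refine sum_congr rfl fun j hj => ?_
    have hj' : 2 * j < θ := by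
      have : j < (θ + 1) / 2 := mem_range.1 hj
      omega
    simp only [f, if_pos hj', expansionCoef, pow_add]
    ring
  · intro s hs
    have hs' : s < 2 * q := mem_range.1 hs
    rcases Nat.even_or_odd s with h | h
    · rw [taylorCoef_eq_zero h hs']
      simp
    · rw [hodd s h (by omega)]
      simp

/-- Near `z = 0` the kernel at `λ = 1` is a polynomial in `z ^ 2` plus `z ^ θ` times a smooth
function. -/
theorem exists_smooth_remainder {m q θ : ℕ} (sgn : Bool) (hθ : 2 * q + θ + 1 ≤ 2 * m) :
    ∃ G : ℝ → ℂ, (∀ k : ℕ, ContDiff ℝ k G) ∧ ∀ z : ℝ, 0 < z →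
      R0Kernel m (2 * q + 1) sgn 1 z =
        ∑ j ∈ range ((θ + 1) / 2), expansionCoef m q sgn j * (z : ℂ) ^ (2 * j) +
          (z : ℂ) ^ (θ : ℤ) * G z := by
  obtain ⟨g, hg, hexp⟩ := exists_taylor_remainder (q := q) (N := 2 * q + θ) (by omega)
  refine ⟨fun z => -Complex.I * kernelFactor m q *
    ∑ k ∈ (if sgn then Finset.range m else Finset.Icc 1 m), lamK m 1 k *
      (Complex.I * lamK m 1 k) ^ (2 * q + θ) * g (Complex.I * lamK m 1 k * z), fun k => ?_,
      fun z hz => ?_⟩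
  · have h1 : ContDiff ℝ k (fun z : ℝ => (z : ℂ)) := Complex.ofRealCLM.contDiff
    have h2 : ContDiff ℝ k g := (hg.contDiff (n := k)).restrict_scalars ℝ
    exact contDiff_const.mul (ContDiff.sum fun i _ =>
      contDiff_const.mul (h2.comp (contDiff_const.mul h1)))
  · have hz' : (z : ℂ) ≠ 0 := by exact_mod_cast hz.ne'
    have hpow : (z : ℂ) ^ (2 * q) ≠ 0 := pow_ne_zero _ hz'
    rw [R0Kernel_one m q sgn hz]
    simp only [hexp, zpow_natCast]
    apply mul_left_cancel₀ hpow
    rw [mul_add, ← sum_taylorCoef_mul_rootSum sgn hθ]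
    simp only [rootSum, mul_sum, mul_add, sum_add_distrib, sum_mul]
    rw [sum_comm (s := range _)]
    have hinv : (z : ℂ) ^ (-(2 * q : ℤ)) = ((z : ℂ) ^ (2 * q))⁻¹ := by
      rw [zpow_neg]
      norm_cast
    rw [hinv]
    congr 1
    · refine sum_congr rfl fun k _ => sum_congr rfl fun s _ => ?_
      field_simp
      ring
    · refine sum_congr rfl fun k _ => ?_
      field_simp
      ring

theorem R0Kernel_derivBoundOn (m q : ℕ) (sgn : Bool) :
    DerivBoundOn (Set.Ici 1) (fun _ => -(q : ℤ)) (fun z => R0Kernel m (2 * q + 1) sgn 1 z) := by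
  have hT : Set.Ici (1 : ℝ) ⊆ Set.Ioi 0 := Set.Ici_subset_Ioi.2 one_pos
  refine DerivBoundOn.congr hT (f := fun z => -Complex.I * kernelFactor m q *
    ∑ k ∈ (if sgn then Finset.range m else Finset.Icc 1 m), ∑ j ∈ range (q + 1),
      (lamK m 1 k * ((polyCoef q j : ℝ) : ℂ) * (Complex.I * lamK m 1 k) ^ j) *
        ((z : ℂ) ^ ((j : ℤ) - 2 * q) * Complex.exp (Complex.I * lamK m 1 k * z))) ?_ ?_
  · refine (DerivBoundOn.fun_sum hT _ fun k hk => DerivBoundOn.fun_sum hT _ fun j hj =>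
      DerivBoundOn.const_mul _ ?_).const_mul _
    have hkm : k ≤ m := by
      cases sgn <;> simp at hk <;> omega
    have hj' : j < q + 1 := mem_range.1 hj
    refine (derivBoundOn_zpow hT _).fun_mul hT (derivBoundOn_cexp hT (I_mul_lamK_re_nonpos hkm)) ?_
    intro l i _ z hz
    rw [zpow_zero, mul_one]
    exact zpow_le_zpow_right₀ hz (by omega)
  · intro z hz
    have hz' : (z : ℂ) ≠ 0 := by exact_mod_cast (ne_of_gt hz : z ≠ 0)
    beta_reduce
    rw [R0Kernel_one m q sgn hz]
    congr 1
    refine sum_congr rfl fun k _ => ?_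
    rw [mul_sum, mul_sum]
    refine sum_congr rfl fun j _ => ?_
    rw [sub_eq_add_neg, zpow_add₀ hz', zpow_natCast, mul_pow _ (z : ℂ)]
    ring

/-- Expansion of the free resolvent kernel, low-order case `0 ≤ θ ≤ 2m - n`,
for odd `1 ≤ n ≤ 2m - 1`. -/
theorem free_resolvent_expansion_low
    (m n θ : ℕ) (hm : 2 ≤ m) (hodd : Odd n) (hn1 : 1 ≤ n) (hn2 : n ≤ 2 * m - 1)
    (hθ : θ ≤ 2 * m - n) (sgn : Bool) :
    ∃ (a : ℕ → ℂ) (r : ℝ → ℂ),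
      (∀ j ∈ Finset.range ((θ + 1) / 2), (a j).im ≠ 0) ∧
      (∀ k : ℕ, ContDiffOn ℝ k r (Set.Ioi 0)) ∧
      (∀ lam : ℝ, 0 < lam → ∀ x y : EuclideanSpace ℝ (Fin n), x ≠ y →
        R0Kernel m n sgn lam (dist x y) =
          (∑ j ∈ Finset.range ((θ + 1) / 2),
            a j * (((lam ^ ((n : ℤ) - 2 * (m : ℤ) + 2 * (j : ℤ))) : ℝ) : ℂ) *
              (((dist x y ^ (2 * j)) : ℝ) : ℂ)) +
          (((lam ^ ((n : ℤ) - 2 * (m : ℤ))) : ℝ) : ℂ) * r (lam * dist x y)) ∧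
      (∀ l : ℕ, ∃ C : ℝ, 0 < C ∧
        (∀ z : ℝ, 0 < z → z ≤ 1 →
          ‖iteratedDerivWithin l r (Set.Ioi 0) z‖ ≤ C * z ^ max ((θ : ℤ) - l) 0) ∧
        (∀ z : ℝ, 1 ≤ z →
          ‖iteratedDerivWithin l r (Set.Ioi 0) z‖ ≤
            C * z ^ max ((θ : ℤ) - l) (-(((n : ℤ) - 1) / 2)))) := by
  obtain ⟨q, rfl⟩ := hodd
  have hθ' : 2 * q + θ + 1 ≤ 2 * m := by omega
  have hm0 : m ≠ 0 := by omega
  obtain ⟨G, hG, hF⟩ := exists_smooth_remainder sgn hθ'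
  have hT₁ : Set.Ioc (0 : ℝ) 1 ⊆ Set.Ioi 0 := fun z hz => hz.1
  have hT₂ : Set.Ici (1 : ℝ) ⊆ Set.Ioi 0 := Set.Ici_subset_Ioi.2 one_pos
  have hsmall : DerivBoundOn (Set.Ioc 0 1) (fun l => max ((θ : ℤ) - l) 0)
      (fun z => (z : ℂ) ^ (θ : ℤ) * G z) := by
    refine (derivBoundOn_pow hT₁ θ).fun_mul hT₁ (derivBoundOn_Ioc_of_contDiff hG) ?_
    intro l i hi z hz
    rw [zpow_zero, mul_one]
    exact zpow_le_zpow_right_of_le_one₀ hz.1 hz.2 (by omega)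
  have hlarge : DerivBoundOn (Set.Ici 1) (fun l => max ((θ : ℤ) - l) (-(q : ℤ)))
      (fun z => (z : ℂ) ^ (θ : ℤ) * G z) := by
    refine DerivBoundOn.congr hT₂ (f := fun z => R0Kernel m (2 * q + 1) sgn 1 z -
      ∑ j ∈ range ((θ + 1) / 2), expansionCoef m q sgn j * (z : ℂ) ^ ((2 * j : ℕ) : ℤ)) ?_ ?_
    · refine DerivBoundOn.sub hT₂ ((R0Kernel_derivBoundOn m q sgn).mono_exponent hT₂ ?_)
        (DerivBoundOn.fun_sum hT₂ _ fun j hj => DerivBoundOn.const_mul _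
          ((derivBoundOn_zpow hT₂ _).mono_exponent hT₂ ?_))
      · intro l z hz
        exact zpow_le_zpow_right₀ hz (le_max_right _ _)
      · intro l z hz
        have hj' : j < (θ + 1) / 2 := mem_range.1 hj
        exact zpow_le_zpow_right₀ hz (by omega)
    · intro z hz
      simp only [hF z hz, zpow_natCast]
      ring
  refine ⟨expansionCoef m q sgn, fun z => (z : ℂ) ^ (θ : ℤ) * G z,
    fun j _ => expansionCoef_im_ne_zero hm0 q sgn j, hsmall.1, fun lam hlam x y hxy => ?_,
    fun l => ?_⟩
  · have hd : 0 < dist x y := dist_pos.2 hxy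
    have hl : (lam : ℂ) ≠ 0 := by exact_mod_cast hlam.ne'
    rw [R0Kernel_scaling m _ sgn hlam hd, hF _ (mul_pos hlam hd), mul_add, mul_sum]
    congr 1
    refine sum_congr rfl fun j _ => ?_
    push_cast
    rw [zpow_add₀ hl, mul_pow, show 2 * (j : ℤ) = ((2 * j : ℕ) : ℤ) by push_cast; rfl, zpow_natCast]
    ring
  · obtain ⟨C₁, hC₁⟩ := hsmall.2 l
    obtain ⟨C₂, hC₂⟩ := hlarge.2 l
    have hq : -((((2 * q + 1 : ℕ) : ℤ) - 1) / 2) = -(q : ℤ) := by omega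
    refine ⟨|C₁| + |C₂| + 1, by positivity, fun z hz hz1 => (hC₁ z ⟨hz, hz1⟩).trans ?_,
      fun z hz => ?_⟩
    · have := le_abs_self C₁
      have := abs_nonneg C₂
      gcongr
      linarith
    · rw [hq]
      have hz0 : 0 < z := hT₂ hz
      refine (hC₂ z hz).trans ?_
      have := le_abs_self C₂
      have := abs_nonneg C₁
      gcongr
      linarith
end

section
/- Let m ≥ 2 be an integer, n odd with 1 ≤ n ≤ 4m−1, and let θ ∈ ℕ₀ with 1 ≤ θ ≤ 4m−n+1. Then there exist constants c_j ∈ ℂ for 0 ≤ j ≤ ⌊(θ−1)/2⌋ and a smooth function ρ_θ : (0,∞) → ℂ such that: (a) for all λ > 0 and all x ≠ y in ℝⁿ, (R₀^+ − R₀^−)(λ^{2m})(x,y) = Σ_{0 ≤ j ≤ ⌊(θ−1)/2⌋} c_j λ^{n−2m+2j} |x−y|^{2j} + λ^{n−2m} ρ_θ(λ|x−y|) (in particular no λ-independent term proportional to |x−y|^{2m−n} occurs in the difference); (b) for every l ∈ ℕ₀ there is C_l > 0 with |d^l ρ_θ/dz^l (z)| ≤ C_l z^{max{θ−l, 0}}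 for 0 < z ≤ 1 and |d^l ρ_θ/dz^l (z)| ≤ C_l z^{max{θ−l, −(n−1)/2}} for z ≥ 1. -/
open MeasureTheory Finset

/-- An entire function vanishing at the origin is divisible by the identity function. -/
theorem exists_entire_eq_mul_of_zero {f : ℂ → ℂ} (hf : Differentiable ℂ f) (h0 : f 0 = 0) :
    ∃ g : ℂ → ℂ, Differentiable ℂ g ∧ ∀ z, f z = z * g z := by
  refine ⟨dslope f 0, ?_, fun z => ?_⟩
  · rw [← differentiableOn_univ]
    exact (Complex.differentiableOn_dslope Filter.univ_mem).2 hf.differentiableOn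
  · have h := sub_smul_dslope f 0 z
    simpa [h0] using h.symm

/-- Even entire functions are expanded in even powers with an entire remainder. -/
theorem exists_even_expansion (K : ℕ) {f : ℂ → ℂ} (hf : Differentiable ℂ f)
    (heven : ∀ z, f (-z) = f z) :
    ∃ (c : ℕ → ℂ) (g : ℂ → ℂ), Differentiable ℂ g ∧
      ∀ z, f z = ∑ j ∈ Finset.range K, c j * z ^ (2 * j) + z ^ (2 * K) * g z := by
  induction K generalizing f with
  | zero => exact ⟨0, f, hf, by simp⟩
  | succ K ih =>
    obtain ⟨g, hg, hfg⟩ := exists_entire_eq_mul_of_zero (f := fun z => f z - f 0)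
      (hf.sub_const _) (by simp)
    have hodd : ∀ z, z ≠ 0 → g (-z) = -g z := fun z hz => by
      have h1 := hfg z
      have h2 := hfg (-z)
      simp only [heven] at h2
      apply mul_left_cancel₀ hz
      linear_combination h2 - h1
    have hg0 : g 0 = 0 := by
      have hclosed : IsClosed {z | g (-z) = -g z} :=
        isClosed_eq (hg.continuous.comp continuous_neg) hg.continuous.neg
      have hdense : Dense ({0}ᶜ : Set ℂ) := dense_compl_singleton 0
      have h := hclosed.closure_subset_iff.2 (fun z hz => hodd z hz) (hdense 0)
      simp only [Set.mem_ofPred_eq, neg_zero] at h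
      exact self_eq_neg.1 h
    obtain ⟨g', hg', hgg'⟩ := exists_entire_eq_mul_of_zero hg hg0
    have heven' : ∀ z, g' (-z) = g' z := fun z => by
      rcases eq_or_ne z 0 with rfl | hz
      · simp
      · have h1 := hodd z hz
        rw [hgg', hgg'] at h1
        apply mul_left_cancel₀ hz
        linear_combination -h1
    obtain ⟨c, e, he, hce⟩ := ih hg' heven'
    refine ⟨fun j => Nat.casesOn j (f 0) c, e, he, fun z => ?_⟩
    have h1 := hfg z
    rw [hgg', hce] at h1
    rw [Finset.sum_range_succ']
    simp only [mul_zero, pow_zero, mul_one]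
    have : ∑ j ∈ Finset.range K, c j * z ^ (2 * (j + 1))
        = z ^ 2 * ∑ j ∈ Finset.range K, c j * z ^ (2 * j) := by
      rw [Finset.mul_sum]
      exact Finset.sum_congr rfl fun j _ => by ring
    rw [this]
    linear_combination h1

/-- A zero of order `k` of the derivative gives a zero of order `k + 1` of the function. -/
theorem exists_entire_eq_pow_mul_of_deriv {D h : ℂ → ℂ} (k : ℕ) (hD : Differentiable ℂ D)
    (h0 : D 0 = 0) (hh : Continuous h) (hderiv : ∀ w, HasDerivAt D (w ^ k * h w) w) :
    ∃ g : ℂ → ℂ, Differentiable ℂ g ∧ ∀ w, D w = w ^ (k + 1) * g w := by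
  suffices H : ∀ j ≤ k + 1, ∃ g : ℂ → ℂ, Differentiable ℂ g ∧ ∀ w, D w = w ^ j * g w from
    H _ le_rfl
  intro j
  induction j with
  | zero => exact fun _ => ⟨D, hD, by simp⟩
  | succ j ih =>
    intro hj
    obtain ⟨g, hg, hDg⟩ := ih (by omega)
    have hg0 : g 0 = 0 := by
      rcases Nat.eq_zero_or_pos j with rfl | hjpos
      · simpa [h0] using (hDg 0).symm
      · obtain ⟨i, rfl⟩ : ∃ i, j = i + 1 := ⟨j - 1, by omega⟩
        obtain ⟨d, rfl⟩ : ∃ d, k = i + 1 + d := ⟨k - (i + 1), by omega⟩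
        have hg' : Continuous (deriv g) := (hg.contDiff (n := 1)).continuous_deriv le_rfl
        have key : ∀ w, w ≠ 0 → ((i + 1 : ℕ) : ℂ) * g w = w * (w ^ d * h w - deriv g w) := by
          intro w hw
          have h1 : HasDerivAt D (((i + 1 : ℕ) : ℂ) * w ^ i * g w + w ^ (i + 1) * deriv g w) w := by
            have h2 := (hasDerivAt_pow (i + 1) w).mul (hg w).hasDerivAt
            have h3 : D = (fun w => w ^ (i + 1)) * g := funext hDg
            rw [h3]
            simpa using h2
          have h4 := h1.unique (hderiv w)
          apply mul_left_cancel₀ (pow_ne_zero i hw)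
          rw [pow_add] at h4
          linear_combination h4
        have hclosed : IsClosed
            {w | ((i + 1 : ℕ) : ℂ) * g w = w * (w ^ d * h w - deriv g w)} :=
          isClosed_eq (continuous_const.mul hg.continuous)
            (continuous_id.mul (((continuous_pow d).mul hh).sub hg'))
        have hdense : Dense ({0}ᶜ : Set ℂ) := dense_compl_singleton 0
        have h := hclosed.closure_subset_iff.2 (fun z hz => key z hz) (hdense 0)
        simp only [Set.mem_ofPred_eq, zero_mul, mul_eq_zero, Nat.cast_eq_zero] at h
        simpa using h
    obtain ⟨g', hg', hgg'⟩ := exists_entire_eq_mul_of_zero hg hg0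
    exact ⟨g', hg', fun w => by rw [hDg, hgg']; ring⟩

/-- The coefficients of the polynomial factor of the kernel in dimension `2 * N + 3`. -/
noncomputable def besselCoeff (N j : ℕ) : ℂ :=
  (-2) ^ j * ((2 * N - j).factorial : ℂ) / ((j.factorial : ℂ) * ((N - j).factorial : ℂ))

/-- The polynomial factor of the kernel in dimension `2 * N + 3`. -/
noncomputable def besselPoly (N : ℕ) : Polynomial ℂ :=
  ∑ j ∈ Finset.range (N + 1), Polynomial.C (besselCoeff N j) * Polynomial.X ^ j

theorem besselPoly_coeff (N k : ℕ) :
    (besselPoly N).coeff k = if k ≤ N then besselCoeff N k else 0 := by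
  simp [besselPoly, Polynomial.coeff_X_pow]

theorem besselPoly_zero : besselPoly 0 = 1 := by
  simp [besselPoly, besselCoeff]

theorem besselPoly_derivative_add (N : ℕ) :
    Polynomial.derivative (besselPoly (N + 1)) + besselPoly (N + 1) =
      Polynomial.C (-2) * (Polynomial.X * besselPoly N) := by
  ext k
  rw [Polynomial.coeff_add, Polynomial.coeff_derivative, Polynomial.coeff_C_mul]
  rcases k with _ | k
  · simp only [besselPoly_coeff, Polynomial.coeff_X_mul_zero, besselCoeff]
    have h : (2 * (N + 1)) = 2 * N + 1 + 1 := by ring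
    simp only [h]
    simp [Nat.factorial_succ]
    have := Nat.factorial_ne_zero N
    field_simp
    ring
  · rw [Polynomial.coeff_X_mul]
    simp only [besselPoly_coeff]
    rcases lt_or_ge N k with hk | hk
    · rw [if_neg (by omega), if_neg (by omega), if_neg (by omega)]
      simp
    · obtain ⟨d, rfl⟩ := Nat.exists_eq_add_of_le hk
      rw [if_pos (by omega : k + 1 ≤ k + d + 1), if_pos hk]
      rcases d with _ | d
      · rw [if_neg (by omega)]
        simp only [besselCoeff]
        rw [show 2 * (k + 0 + 1) - (k + 1) = k + 1 by omega, show 2 * (k + 0) - k = k by omega]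
        have := Nat.factorial_ne_zero k
        have := Nat.factorial_ne_zero (k + 1)
        simp
        field_simp
        ring
      · rw [if_pos (by omega)]
        simp only [besselCoeff]
        rw [show 2 * (k + (d + 1) + 1) - (k + 1 + 1) = k + 2 * d + 2 by omega,
          show 2 * (k + (d + 1) + 1) - (k + 1) = k + 2 * d + 2 + 1 by omega,
          show 2 * (k + (d + 1)) - k = k + 2 * d + 2 by omega,
          show k + (d + 1) + 1 - (k + 1 + 1) = d by omega,
          show k + (d + 1) + 1 - (k + 1) = d + 1 by omega,
          show k + (d + 1) - k = d + 1 by omega,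
          Nat.factorial_succ (k + 2 * d + 2), Nat.factorial_succ (k + 1), Nat.factorial_succ k,
          Nat.factorial_succ d]
        have h1 : (k.factorial : ℂ) ≠ 0 := by exact_mod_cast Nat.factorial_ne_zero k
        have h2 : (d.factorial : ℂ) ≠ 0 := by exact_mod_cast Nat.factorial_ne_zero d
        have h3 : (k : ℂ) + 1 ≠ 0 := by exact_mod_cast Nat.succ_ne_zero k
        have h4 : (k : ℂ) + 1 + 1 ≠ 0 := by exact_mod_cast Nat.succ_ne_zero (k + 1)
        have h5 : (d : ℂ) + 1 ≠ 0 := by exact_mod_cast Nat.succ_ne_zero d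
        push_cast
        field_simp
        ring

theorem hasDerivAt_exp_mul_besselPoly (N : ℕ) (w : ℂ) :
    HasDerivAt (fun w => Complex.exp w * (besselPoly (N + 1)).eval w)
      (-2 * w * (Complex.exp w * (besselPoly N).eval w)) w := by
  have h := (Complex.hasDerivAt_exp w).mul ((besselPoly (N + 1)).hasDerivAt w)
  have h2 := congrArg (Polynomial.eval w) (besselPoly_derivative_add N)
  simp only [Polynomial.eval_add, Polynomial.eval_mul, Polynomial.eval_C, Polynomial.eval_X] at h2
  refine h.congr_deriv ?_
  linear_combination Complex.exp w * h2

/-- The odd part of `exp w * besselPoly N w` vanishes to order `2 * N + 1` at the origin. -/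
theorem exists_odd_part_exp_mul_besselPoly (N : ℕ) :
    ∃ g : ℂ → ℂ, Differentiable ℂ g ∧ ∀ w, Complex.exp w * (besselPoly N).eval w -
      Complex.exp (-w) * (besselPoly N).eval (-w) = w ^ (2 * N + 1) * g w := by
  induction N with
  | zero =>
    obtain ⟨g, hg, h⟩ := exists_entire_eq_mul_of_zero
      (f := fun w => Complex.exp w - Complex.exp (-w))
      (Complex.differentiable_exp.sub (Complex.differentiable_exp.comp differentiable_neg))
      (by simp)
    exact ⟨g, hg, fun w => by simpa [besselPoly_zero] using h w⟩
  | succ N ih =>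
    obtain ⟨g, hg, h⟩ := ih
    have hderiv : ∀ w, HasDerivAt (fun w => Complex.exp w * (besselPoly (N + 1)).eval w -
        Complex.exp (-w) * (besselPoly (N + 1)).eval (-w)) (w ^ (2 * N + 2) * (-2 * g w)) w := by
      intro w
      have h1 := hasDerivAt_exp_mul_besselPoly N w
      have h2 := (hasDerivAt_exp_mul_besselPoly N (-w)).comp w (hasDerivAt_neg w)
      refine (h1.sub h2).congr_deriv ?_
      linear_combination (-2 * w) * h w
    exact exists_entire_eq_pow_mul_of_deriv (2 * N + 2) (fun w => (hderiv w).differentiableAt)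
      (by simp) (continuous_const.mul hg.continuous) hderiv

/-- Differentiation lowers a monomial prefactor by at most one power. -/
theorem exists_iteratedDerivWithin_pow_mul (l : ℕ) : ∀ (a : ℕ) {g : ℝ → ℂ},
    (∀ k : ℕ, ContDiff ℝ k g) → ∃ h : ℝ → ℂ, (∀ k : ℕ, ContDiff ℝ k h) ∧
      ∀ z ∈ Set.Ioi (0 : ℝ), iteratedDerivWithin l (fun z : ℝ => (z : ℂ) ^ a * g z) (Set.Ioi 0) z =
        (z : ℂ) ^ (a - l) * h z := by
  induction l with
  | zero => exact fun a g hg => ⟨g, hg, by simp⟩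
  | succ l ih =>
    intro a g hg
    have hg' : ∀ k : ℕ, ContDiff ℝ k (deriv g) := fun k =>
      (contDiff_succ_iff_deriv.1 (by exact_mod_cast hg (k + 1))).2.2
    have hgd : ∀ z, HasDerivAt g (deriv g z) z := fun z =>
      (((hg 1).differentiable (by simp)) z).hasDerivAt
    have hpow : ∀ z : ℝ, HasDerivAt (fun z : ℝ => (z : ℂ) ^ a) (a * (z : ℂ) ^ (a - 1)) z :=
      fun z => by simpa using (hasDerivAt_pow a (z : ℂ)).comp_ofReal
    have hof : ∀ k : ℕ, ContDiff ℝ k (fun z : ℝ => (z : ℂ)) :=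
      fun k => Complex.ofRealCLM.contDiff
    obtain ⟨e, he, hd⟩ : ∃ e : ℝ → ℂ, (∀ k : ℕ, ContDiff ℝ k e) ∧ ∀ z : ℝ,
        HasDerivAt (fun z : ℝ => (z : ℂ) ^ a * g z) ((z : ℂ) ^ (a - 1) * e z) z := by
      rcases a with _ | a
      · exact ⟨deriv g, hg', fun z => by simpa using hgd z⟩
      · refine ⟨fun z => (a + 1 : ℂ) * g z + z * deriv g z, fun k =>
          (contDiff_const.mul (hg k)).add ((hof k).mul (hg' k)), fun z => ?_⟩
        refine ((hpow z).mul (hgd z)).congr_deriv ?_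
        simp only [Nat.add_sub_cancel, Nat.cast_add, Nat.cast_one]
        ring
    obtain ⟨h, hh, hl⟩ := ih (a - 1) he
    refine ⟨h, hh, fun z hz => ?_⟩
    rw [iteratedDerivWithin_succ', show a - (l + 1) = a - 1 - l by omega, ← hl z hz]
    exact iteratedDerivWithin_congr (fun y hy =>
      (hd y).hasDerivWithinAt.derivWithin (uniqueDiffOn_Ioi 0 y hy)) hz

/-- Derivatives of `z ^ a * exp (b * z)` times a polynomial in `z⁻¹` have the same form. -/
theorem exists_iteratedDerivWithin_zpow_mul_exp (l : ℕ) (a : ℤ) (b : ℂ) : ∀ P : Polynomial ℂ,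
    ∃ Q : Polynomial ℂ, ∀ z ∈ Set.Ioi (0 : ℝ), iteratedDerivWithin l
      (fun z : ℝ => (z : ℂ) ^ a * Complex.exp (b * z) * P.eval (z : ℂ)⁻¹) (Set.Ioi 0) z =
        (z : ℂ) ^ a * Complex.exp (b * z) * Q.eval (z : ℂ)⁻¹ := by
  induction l with
  | zero => exact fun P => ⟨P, by simp⟩
  | succ l ih =>
    intro P
    obtain ⟨Q, hQ⟩ := ih (Polynomial.C (a : ℂ) * Polynomial.X * P + Polynomial.C b * P -
      Polynomial.X ^ 2 * Polynomial.derivative P)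
    refine ⟨Q, fun z hz => ?_⟩
    rw [iteratedDerivWithin_succ', ← hQ z hz]
    refine iteratedDerivWithin_congr (fun y hy => ?_) hz
    have hy0 : (y : ℂ) ≠ 0 := by exact_mod_cast (ne_of_gt hy)
    have h1 := hasDerivAt_zpow a (y : ℂ) (Or.inl hy0)
    have h2 : HasDerivAt (fun z : ℂ => Complex.exp (b * z)) (Complex.exp (b * y) * b) (y : ℂ) := by
      simpa using ((hasDerivAt_id (y : ℂ)).const_mul b).cexp
    have h3 := (P.hasDerivAt (y : ℂ)⁻¹).comp (y : ℂ) (hasDerivAt_inv hy0)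
    have h4 := ((h1.mul h2).mul h3).comp_ofReal
    refine Eq.trans (h4.hasDerivWithinAt.derivWithin (uniqueDiffOn_Ioi 0 y hy)) ?_
    simp only [Polynomial.eval_add, Polynomial.eval_sub, Polynomial.eval_mul, Polynomial.eval_C,
      Polynomial.eval_X, Polynomial.eval_pow, zpow_sub_one₀ hy0, Function.comp, Pi.mul_apply]
    field_simp
    ring

/-- A bound for a polynomial in `z⁻¹` for `z ≥ 1`. -/
theorem exists_bound_eval_inv (P : Polynomial ℂ) :
    ∃ C : ℝ, 0 ≤ C ∧ ∀ z : ℝ, 1 ≤ z → ‖P.eval (z : ℂ)⁻¹‖ ≤ C := by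
  obtain ⟨C, hC⟩ := (isCompact_Icc (a := (0 : ℝ)) (b := 1)).exists_bound_of_continuousOn
    (f := fun t : ℝ => P.eval (t : ℂ)) (by fun_prop)
  refine ⟨C, (norm_nonneg _).trans (hC 0 (by simp)), fun z hz => ?_⟩
  have := hC z⁻¹ ⟨by positivity, inv_le_one_of_one_le₀ hz⟩
  simpa using this

/-- The profile of one summand of the free resolvent kernel. -/
noncomputable def kernelProfile (n : ℕ) (w : ℂ) : ℂ :=
  Complex.exp w * ∑ j ∈ Finset.Icc (min 0 (((n : ℤ) - 3) / 2)) (((n : ℤ) - 3) / 2),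
    ((cCoef n j : ℝ) : ℂ) * w ^ j

theorem kernelProfile_one (w : ℂ) : kernelProfile 1 w = -(1 / 2) * (Complex.exp w * w⁻¹) := by
  have h : ((1 : ℤ) - 3) / 2 = -1 := by norm_num
  simp only [kernelProfile, Nat.cast_one, h]
  simp [cCoef]
  ring

theorem kernelProfile_two_mul_add_three (N : ℕ) (w : ℂ) :
    kernelProfile (2 * N + 3) w = Complex.exp w * (besselPoly N).eval w := by
  have h : (((2 * N + 3 : ℕ) : ℤ) - 3) / 2 = N := by push_cast; omega
  simp only [kernelProfile, h, besselPoly, Polynomial.eval_finsetSum]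
  congr 1
  rw [min_eq_left (by positivity)]
  symm
  refine Finset.sum_bij (fun j _ => (j : ℤ)) (fun j hj => ?_) (fun _ _ _ _ h => by exact_mod_cast h)
    (fun j hj => ?_) (fun j hj => ?_)
  · simp only [Finset.mem_range] at hj
    simp only [Finset.mem_Icc]
    omega
  · simp only [Finset.mem_Icc] at hj
    exact ⟨j.toNat, by simp only [Finset.mem_range]; omega, by omega⟩
  · have h1 : (j : ℤ) ≠ -1 := by omega
    have h2 : ((N : ℤ) - j).toNat = N - j := by omega
    simp only [cCoef, h1, if_false, h, h2, Int.toNat_natCast, besselCoeff, zpow_natCast,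
      Nat.add_sub_cancel]
    simp

theorem R0Kernel_sub (m n : ℕ) (hm : m ≠ 0) (lam r : ℝ) :
    R0Kernel m n true lam r - R0Kernel m n false lam r =
      ((((4 * Real.pi) ^ (-(((n : ℝ) - 1) / 2)) : ℝ)) : ℂ) * ((m : ℂ) * (lam : ℂ) ^ (2 * m))⁻¹ *
        ((lam : ℂ) ^ 2 * (r : ℂ) ^ (-((n : ℤ) - 2)) *
          (kernelProfile n (Complex.I * (lam * r : ℝ)) -
            kernelProfile n (-(Complex.I * (lam * r : ℝ))))) := by
  have h0 : lamK m lam 0 = lam := by simp [lamK]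
  have hm' : lamK m lam m = -lam := by
    have : Complex.I * (m : ℂ) * (Real.pi : ℂ) / (m : ℂ) = Real.pi * Complex.I := by
      field_simp
    rw [lamK, this, Complex.exp_pi_mul_I]
    ring
  have hsum : ∀ t : ℕ → ℂ,
      ∑ k ∈ Finset.range m, t k - ∑ k ∈ Finset.Icc 1 m, t k = t 0 - t m := by
    intro t
    have h1 := Finset.sum_range_succ t m
    have h2 := Finset.sum_range_succ' t m
    have h3 : ∑ k ∈ Finset.Icc 1 m, t k = ∑ k ∈ Finset.range m, t (k + 1) := by
      rw [Finset.range_eq_Ico, Finset.sum_Ico_add' t 0 m 1]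
      rfl
    rw [h3]
    linear_combination h2 - h1
  simp only [R0Kernel, if_true, Bool.false_eq_true, if_false]
  rw [← mul_sub, hsum, h0, hm']
  simp only [kernelProfile]
  congr 1
  rw [show Complex.I * -(lam : ℂ) * (r : ℂ) = -(Complex.I * (lam * r : ℝ)) by push_cast; ring,
    show Complex.I * (lam : ℂ) * (r : ℂ) = Complex.I * (lam * r : ℝ) by push_cast; ring]
  ring

/-- The rescaled difference of the profiles extends to an even entire function, and it is
oscillating with an amplitude of order `z ^ (-(n - 1) / 2)` for large `z`. -/
theorem exists_kernelProfile_sub (n : ℕ) (hn : Odd n) :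
    ∃ (E : ℂ → ℂ) (P Q : Polynomial ℂ), Differentiable ℂ E ∧ (∀ z, E (-z) = E z) ∧
      (∀ z : ℝ, 0 < z → (z : ℂ) ^ (-((n : ℤ) - 2)) * (kernelProfile n (Complex.I * z) -
        kernelProfile n (-(Complex.I * z))) = E z) ∧
      ∀ z : ℝ, 0 < z → E z =
        (z : ℂ) ^ (-(((n : ℤ) - 1) / 2)) * Complex.exp (Complex.I * z) * P.eval (z : ℂ)⁻¹ +
        (z : ℂ) ^ (-(((n : ℤ) - 1) / 2)) * Complex.exp (-Complex.I * z) * Q.eval (z : ℂ)⁻¹ := by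
  obtain ⟨M, rfl⟩ := hn
  rcases M with _ | N
  · refine ⟨fun z => Complex.I / 2 * (Complex.exp (Complex.I * z) + Complex.exp (-Complex.I * z)),
      Polynomial.C (Complex.I / 2), Polynomial.C (Complex.I / 2), by fun_prop, fun z => ?_,
      fun z hz => ?_, fun z hz => ?_⟩
    · simp only [mul_neg, neg_mul, neg_neg]
      ring
    · have hz' : (z : ℂ) ≠ 0 := by exact_mod_cast hz.ne'
      rw [show 2 * 0 + 1 = 1 by norm_num, kernelProfile_one, kernelProfile_one]
      norm_num [Complex.inv_I]
      field_simp
    · simp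
      ring
  · obtain ⟨g, hg, hE⟩ := exists_odd_part_exp_mul_besselPoly N
    have hn : 2 * (N + 1) + 1 = 2 * N + 3 := by ring
    have he1 : -(((2 * N + 3 : ℕ) : ℤ) - 2) = -((2 * N + 1 : ℕ) : ℤ) := by push_cast; ring
    have he2 : -((((2 * N + 3 : ℕ) : ℤ) - 1) / 2) = -((N + 1 : ℕ) : ℤ) := by push_cast; omega
    have heven : ∀ w, g (-w) = g w := by
      have hclosed : IsClosed {w | g (-w) = g w} :=
        isClosed_eq (hg.continuous.comp continuous_neg) hg.continuous
      have hdense : Dense ({0}ᶜ : Set ℂ) := dense_compl_singleton 0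
      refine fun w => hclosed.closure_subset_iff.2 (fun z hz => ?_) (hdense w)
      have h1 := hE z
      have h2 := hE (-z)
      rw [neg_neg, Odd.neg_pow ⟨N, rfl⟩] at h2
      apply mul_left_cancel₀ (pow_ne_zero (2 * N + 1) hz)
      linear_combination h1 + h2
    have hprofile : ∀ z : ℝ, 0 < z → (z : ℂ) ^ (-(((2 * N + 3 : ℕ) : ℤ) - 2)) *
        (kernelProfile (2 * N + 3) (Complex.I * z) -
          kernelProfile (2 * N + 3) (-(Complex.I * z))) =
        Complex.I ^ (2 * N + 1) * g (Complex.I * z) := by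
      intro z hz
      have hz' : (z : ℂ) ≠ 0 := by exact_mod_cast hz.ne'
      rw [kernelProfile_two_mul_add_three, kernelProfile_two_mul_add_three, hE, he1, zpow_neg,
        zpow_natCast, mul_pow]
      field_simp
    have hpoly : ∀ b : ℂ, ∃ R : Polynomial ℂ, ∀ z : ℝ, 0 < z →
        (z : ℂ) ^ (-((2 * N + 1 : ℕ) : ℤ)) * (besselPoly N).eval (b * z) =
          (z : ℂ) ^ (-((N + 1 : ℕ) : ℤ)) * R.eval (z : ℂ)⁻¹ := by
      intro b
      refine ⟨∑ j ∈ Finset.range (N + 1), Polynomial.C (besselCoeff N j * b ^ j) *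
        Polynomial.X ^ (N - j), fun z hz => ?_⟩
      have hz' : (z : ℂ) ≠ 0 := by exact_mod_cast hz.ne'
      simp only [besselPoly, Polynomial.eval_finsetSum, Finset.mul_sum, Polynomial.eval_mul,
        Polynomial.eval_C, Polynomial.eval_pow, Polynomial.eval_X]
      refine Finset.sum_congr rfl fun j hj => ?_
      obtain ⟨d, rfl⟩ := Nat.exists_eq_add_of_le (Nat.lt_succ_iff.1 (Finset.mem_range.1 hj))
      rw [zpow_neg, zpow_neg, zpow_natCast, zpow_natCast, Nat.add_sub_cancel_left, inv_pow,
        mul_pow]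
      field_simp
      ring
    obtain ⟨P, hP⟩ := hpoly Complex.I
    obtain ⟨Q, hQ⟩ := hpoly (-Complex.I)
    rw [hn]
    refine ⟨fun z => Complex.I ^ (2 * N + 1) * g (Complex.I * z), P, -Q, by fun_prop, fun z => ?_,
      hprofile, fun z hz => ?_⟩
    · simp only [mul_neg, heven]
    · simp only [← hprofile z hz]
      rw [kernelProfile_two_mul_add_three, kernelProfile_two_mul_add_three, he1, he2,
        Polynomial.eval_neg]
      have h1 := hP z hz
      have h2 := hQ z hz
      rw [neg_mul] at h2
      rw [neg_mul]
      linear_combination Complex.exp (Complex.I * z) * h1 - Complex.exp (-(Complex.I * z)) * h2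

/-- Derivatives of even powers of order less than `θ` grow at most like `z ^ (θ - l)`. -/
theorem exists_bound_iteratedDerivWithin_even_sum (θ l : ℕ) (e : ℤ) (c : ℕ → ℂ) :
    ∃ C : ℝ, 0 ≤ C ∧ ∀ z : ℝ, 1 ≤ z → ‖iteratedDerivWithin l (fun z : ℝ =>
      ∑ j ∈ Finset.range ((θ + 1) / 2), c j * (z : ℂ) ^ (2 * j)) (Set.Ioi 0) z‖ ≤
        C * z ^ max ((θ : ℤ) - l) e := by
  have hterm : ∀ (k : ℕ) (z : ℝ), 0 < z → iteratedDerivWithin l (fun z : ℝ => (z : ℂ) ^ k)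
      (Set.Ioi 0) z = (k.descFactorial l : ℂ) * (z : ℂ) ^ (k - l) := by
    intro k
    induction l generalizing k with
    | zero => simp
    | succ l ih =>
      intro z hz
      have hd : ∀ y ∈ Set.Ioi (0 : ℝ), derivWithin (fun z : ℝ => (z : ℂ) ^ k) (Set.Ioi 0) y =
          (k : ℂ) * (y : ℂ) ^ (k - 1) := fun y hy => by
        simpa using (hasDerivAt_pow k (y : ℂ)).comp_ofReal.hasDerivWithinAt.derivWithin
          (uniqueDiffOn_Ioi 0 y hy)
      rw [iteratedDerivWithin_succ', iteratedDerivWithin_congr hd hz]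
      rw [iteratedDerivWithin_const_mul (Set.mem_Ioi.2 hz) (uniqueDiffOn_Ioi 0)]
      · rw [ih _ z hz]
        rcases k with _ | k
        · simp
        · rw [Nat.succ_descFactorial_succ, Nat.add_sub_add_right]
          push_cast
          simp [mul_assoc]
      · exact ((Complex.ofRealCLM.contDiff.pow _).contDiffWithinAt)
  refine ⟨∑ j ∈ Finset.range ((θ + 1) / 2), ‖c j‖ * ((2 * j).descFactorial l : ℝ),
    Finset.sum_nonneg fun j _ => by positivity, fun z hz => ?_⟩
  have hz0 : (0 : ℝ) < z := by linarith
  have hcd : ∀ k : ℕ, ContDiffWithinAt ℝ l (fun z : ℝ => (z : ℂ) ^ k) (Set.Ioi 0) z :=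
    fun k => (Complex.ofRealCLM.contDiff.pow k).contDiffWithinAt
  rw [iteratedDerivWithin_fun_sum (Set.mem_Ioi.2 hz0) (uniqueDiffOn_Ioi 0)
    (fun j _ => contDiffWithinAt_const.mul (hcd _)), Finset.sum_mul]
  refine (norm_sum_le _ _).trans (Finset.sum_le_sum fun j hj => ?_)
  rw [iteratedDerivWithin_const_mul (Set.mem_Ioi.2 hz0) (uniqueDiffOn_Ioi 0) _ (hcd _),
    hterm _ z hz0, norm_mul, norm_mul, ← mul_assoc, Complex.norm_natCast, norm_pow, Complex.norm_real,
    Real.norm_of_nonneg hz0.le]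
  rcases lt_or_ge (2 * j) l with h | h
  · rw [Nat.descFactorial_of_lt h]
    simp
  · refine mul_le_mul_of_nonneg_left ?_ (by positivity)
    rw [← zpow_natCast]
    refine zpow_le_zpow_right₀ hz (le_max_of_le_left ?_)
    have := Finset.mem_range.1 hj
    omega

/-- An oscillating term with bounded amplitude is controlled by a power of `z ≥ 1`. -/
theorem norm_zpow_mul_exp_mul_le {z C : ℝ} {a b : ℤ} {u p : ℂ} (hz : 1 ≤ z) (hab : a ≤ b)
    (hu : u.re = 0) (hp : ‖p‖ ≤ C) (hC : 0 ≤ C) :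
    ‖(z : ℂ) ^ a * Complex.exp (u * z) * p‖ ≤ C * z ^ b := by
  have hz0 : (0 : ℝ) < z := by linarith
  have h1 : ‖Complex.exp (u * z)‖ = 1 := by
    simp [Complex.norm_exp, hu]
  rw [norm_mul, norm_mul, h1, norm_zpow, Complex.norm_real, Real.norm_of_nonneg hz0.le, mul_one,
    mul_comm]
  exact mul_le_mul hp (zpow_le_zpow_right₀ hz hab) (by positivity) hC

/-- Expansion of the difference `R₀⁺ - R₀⁻` of the free resolvent kernels, for
`1 ≤ θ ≤ 4m - n + 1`: no λ-independent term proportional to `|x-y|^{2m-n}` occurs. -/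
theorem free_resolvent_difference_expansion
    (m n θ : ℕ) (hm : 2 ≤ m) (hodd : Odd n) (hn1 : 1 ≤ n) (hn2 : n ≤ 4 * m - 1)
    (hθ1 : 1 ≤ θ) (hθ2 : θ ≤ 4 * m - n + 1) :
    ∃ (c : ℕ → ℂ) (ρ : ℝ → ℂ),
      (∀ k : ℕ, ContDiffOn ℝ k ρ (Set.Ioi 0)) ∧
      (∀ lam : ℝ, 0 < lam → ∀ x y : EuclideanSpace ℝ (Fin n), x ≠ y →
        R0Kernel m n true lam (dist x y) - R0Kernel m n false lam (dist x y) =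
          (∑ j ∈ Finset.range ((θ + 1) / 2),
            c j * (((lam ^ ((n : ℤ) - 2 * (m : ℤ) + 2 * (j : ℤ))) : ℝ) : ℂ) *
              (((dist x y ^ (2 * j)) : ℝ) : ℂ)) +
          (((lam ^ ((n : ℤ) - 2 * (m : ℤ))) : ℝ) : ℂ) * ρ (lam * dist x y)) ∧
      (∀ l : ℕ, ∃ C : ℝ, 0 < C ∧
        (∀ z : ℝ, 0 < z → z ≤ 1 →
          ‖iteratedDerivWithin l ρ (Set.Ioi 0) z‖ ≤ C * z ^ max ((θ : ℤ) - l) 0) ∧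
        (∀ z : ℝ, 1 ≤ z →
          ‖iteratedDerivWithin l ρ (Set.Ioi 0) z‖ ≤
            C * z ^ max ((θ : ℤ) - l) (-(((n : ℤ) - 1) / 2)))) := by
  obtain ⟨E, P, Q, hE, heven, hEk, hEosc⟩ := exists_kernelProfile_sub n hodd
  set A : ℂ := ((((4 * Real.pi) ^ (-(((n : ℝ) - 1) / 2)) : ℝ)) : ℂ) * (m : ℂ)⁻¹ with hA
  obtain ⟨c, g, hg, hexp⟩ := exists_even_expansion ((θ + 1) / 2)
    (f := fun z => A * E z) (hE.const_mul A) (fun z => by rw [heven])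
  have hgs : ∀ k : ℕ, ContDiff ℝ k (fun z : ℝ => g z) := fun k =>
    (hg.contDiff.restrict_scalars ℝ).comp Complex.ofRealCLM.contDiff
  have hofs : ∀ k : ℕ, ContDiff ℝ k (fun z : ℝ => (z : ℂ)) := fun k => Complex.ofRealCLM.contDiff
  refine ⟨c, fun z : ℝ => (z : ℂ) ^ (2 * ((θ + 1) / 2)) * g z,
    fun k => (((hofs k).pow _).mul (hgs k)).contDiffOn, ?_, fun l => ?_⟩
  · intro lam hlam x y hxy
    have hr : 0 < dist x y := dist_pos.2 hxy
    generalize dist x y = r at hr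
    have hlam' : (lam : ℂ) ≠ 0 := by exact_mod_cast hlam.ne'
    have hr' : (r : ℂ) ≠ 0 := by exact_mod_cast hr.ne'
    have hm' : (m : ℂ) ≠ 0 := by exact_mod_cast (by omega : m ≠ 0)
    have h1 := hEk (lam * r) (mul_pos hlam hr)
    have h2 := hexp ((lam * r : ℝ) : ℂ)
    have h3 : ∑ j ∈ Finset.range ((θ + 1) / 2),
        c j * (((lam ^ ((n : ℤ) - 2 * (m : ℤ) + 2 * (j : ℤ))) : ℝ) : ℂ) *
          (((r ^ (2 * j)) : ℝ) : ℂ) =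
        (lam : ℂ) ^ ((n : ℤ) - 2 * (m : ℤ)) *
          ∑ j ∈ Finset.range ((θ + 1) / 2), c j * ((lam * r : ℝ) : ℂ) ^ (2 * j) := by
      rw [Finset.mul_sum]
      refine Finset.sum_congr rfl fun j _ => ?_
      have : (lam : ℂ) ^ ((n : ℤ) - 2 * (m : ℤ) + 2 * (j : ℤ)) =
          (lam : ℂ) ^ ((n : ℤ) - 2 * (m : ℤ)) * (lam : ℂ) ^ (2 * j) := by
        rw [zpow_add₀ hlam', ← zpow_natCast (lam : ℂ) (2 * j)]
        push_cast
        rfl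
      push_cast
      rw [this]
      ring
    have h4 : (lam : ℂ) ^ ((n : ℤ) - 2 * (m : ℤ)) * (lam : ℂ) ^ (-((n : ℤ) - 2)) =
        ((lam : ℂ) ^ (2 * m))⁻¹ * (lam : ℂ) ^ 2 := by
      rw [← zpow_add₀ hlam', ← zpow_natCast (lam : ℂ) (2 * m), ← zpow_neg,
        ← zpow_natCast (lam : ℂ) 2, ← zpow_add₀ hlam']
      congr 1
      push_cast
      ring
    rw [R0Kernel_sub m n (by omega), h3, Complex.ofReal_zpow, ← mul_add, ← h2, ← h1,
      Complex.ofReal_mul lam r, mul_zpow, mul_inv]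
    linear_combination (-A * (r : ℂ) ^ (-((n : ℤ) - 2)) *
      (kernelProfile n (Complex.I * (lam * r)) - kernelProfile n (-(Complex.I * (lam * r))))) * h4
  · obtain ⟨h, hh, hsmall⟩ := exists_iteratedDerivWithin_pow_mul l (2 * ((θ + 1) / 2)) hgs
    obtain ⟨C₀, hC₀⟩ := (isCompact_Icc (a := (0 : ℝ)) (b := 1)).exists_bound_of_continuousOn
      (hh 0).continuous.continuousOn
    have hC₀0 : 0 ≤ C₀ := (norm_nonneg _).trans (hC₀ 0 (by simp))
    obtain ⟨P', hP'⟩ := exists_iteratedDerivWithin_zpow_mul_exp l (-(((n : ℤ) - 1) / 2))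
      Complex.I (Polynomial.C A * P)
    obtain ⟨Q', hQ'⟩ := exists_iteratedDerivWithin_zpow_mul_exp l (-(((n : ℤ) - 1) / 2))
      (-Complex.I) (Polynomial.C A * Q)
    obtain ⟨C₁, hC₁0, hC₁⟩ := exists_bound_eval_inv P'
    obtain ⟨C₂, hC₂0, hC₂⟩ := exists_bound_eval_inv Q'
    obtain ⟨C₃, hC₃0, hC₃⟩ := exists_bound_iteratedDerivWithin_even_sum θ l
      (-(((n : ℤ) - 1) / 2)) c
    refine ⟨C₀ + C₁ + C₂ + C₃ + 1, by positivity, fun z hz hz1 => ?_, fun z hz => ?_⟩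
    · rw [hsmall z hz, norm_mul, norm_pow, Complex.norm_real, Real.norm_of_nonneg hz.le, mul_comm]
      refine mul_le_mul ((hC₀ z ⟨hz.le, hz1⟩).trans (by linarith)) ?_ (by positivity)
        (by positivity)
      rw [← zpow_natCast]
      exact zpow_le_zpow_right_of_le_one₀ hz hz1 (by omega)
    · have hz0 : (0 : ℝ) < z := by linarith
      have hcongr : Set.EqOn (fun z : ℝ => (z : ℂ) ^ (2 * ((θ + 1) / 2)) * g z)
          ((fun z : ℝ => (z : ℂ) ^ (-(((n : ℤ) - 1) / 2)) * Complex.exp (Complex.I * z) *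
              (Polynomial.C A * P).eval (z : ℂ)⁻¹ +
            (z : ℂ) ^ (-(((n : ℤ) - 1) / 2)) * Complex.exp (-Complex.I * z) *
              (Polynomial.C A * Q).eval (z : ℂ)⁻¹) - fun z : ℝ =>
            ∑ j ∈ Finset.range ((θ + 1) / 2), c j * (z : ℂ) ^ (2 * j)) (Set.Ioi 0) := by
        intro y hy
        have h1 := hexp y
        have h2 := hEosc y hy
        simp only [Pi.sub_apply, Polynomial.eval_mul, Polynomial.eval_C]
        linear_combination A * h2 - h1
      have hosc : ∀ (b : ℂ) (R : Polynomial ℂ), ContDiffWithinAt ℝ l (fun z : ℝ =>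
          (z : ℂ) ^ (-(((n : ℤ) - 1) / 2)) * Complex.exp (b * z) * R.eval (z : ℂ)⁻¹)
          (Set.Ioi 0) z := by
        intro b R
        have hzc : (z : ℂ) ≠ 0 := by exact_mod_cast hz0.ne'
        have hinv : ContDiffAt ℝ l (fun z : ℝ => (z : ℂ)⁻¹) z := (hofs l).contDiffAt.inv hzc
        have hpow : ∀ e : ℕ, ContDiffAt ℝ l (fun z : ℝ => (z : ℂ) ^ (-(e : ℤ))) z := fun e => by
          simpa only [zpow_neg, zpow_natCast, inv_pow] using hinv.pow e
        have hR : ContDiffAt ℝ l (fun z : ℝ => R.eval (z : ℂ)⁻¹) z :=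
          ((R.differentiable.contDiff (n := l)).restrict_scalars ℝ).contDiffAt.comp z hinv
        obtain ⟨e, he⟩ : ∃ e : ℕ, ((n : ℤ) - 1) / 2 = e :=
          ⟨(((n : ℤ) - 1) / 2).toNat, by omega⟩
        rw [he]
        exact (((hpow e).mul (contDiff_const.mul (hofs l)).contDiffAt.cexp).mul hR).contDiffWithinAt
      have hsum : ContDiffWithinAt ℝ l (fun z : ℝ =>
          ∑ j ∈ Finset.range ((θ + 1) / 2), c j * (z : ℂ) ^ (2 * j)) (Set.Ioi 0) z :=
        (ContDiff.sum fun j _ => contDiff_const.mul ((hofs l).pow _)).contDiffWithinAt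
      rw [iteratedDerivWithin_congr hcongr hz0,
        iteratedDerivWithin_sub (Set.mem_Ioi.2 hz0) (uniqueDiffOn_Ioi 0)
          ((hosc _ _).add (hosc _ _)) hsum,
        iteratedDerivWithin_fun_add (Set.mem_Ioi.2 hz0) (uniqueDiffOn_Ioi 0) (hosc _ _) (hosc _ _),
        hP' z hz0, hQ' z hz0]
      have hb1 := norm_zpow_mul_exp_mul_le hz (le_max_right ((θ : ℤ) - l) (-(((n : ℤ) - 1) / 2)))
        Complex.I_re (hC₁ z hz) hC₁0
      have hb2 := norm_zpow_mul_exp_mul_le hz (le_max_right ((θ : ℤ) - l) (-(((n : ℤ) - 1) / 2)))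
        (u := -Complex.I) (by simp) (hC₂ z hz) hC₂0
      have hb3 := hC₃ z hz
      have hpos : 0 ≤ z ^ max ((θ : ℤ) - l) (-(((n : ℤ) - 1) / 2)) := by positivity
      refine (norm_sub_le_of_le (norm_add_le_of_le hb1 hb2) hb3).trans ?_
      nlinarith [mul_nonneg hC₀0 hpos]
end
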